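/- There exist a real constant c' > 0 and a natural number n₀ such that for all integers k ≥ 1 and n ≥ n₀, every extended formulation of the polytope STAB_{k²}(PLC(k,n)) has size at least n^{c'·k}. -/

import Mathlib

/-- A set of vertices is independent in `G` if no two of its elements are adjacent. -/
def IsIndepSet {V : Type*} (G : SimpleGraph V) (S : Set V) : Prop :=
  ∀ ⦃u⦄, u ∈ S → ∀ ⦃v⦄, v ∈ S → ¬ G.Adj u v

/-- The characteristic vector of a finite vertex set `S`. -/
noncomputable def charVec {V : Type*} (S : Finset V) : V → ℝ :=
  Set.indicator (↑S) (fun _ => 1)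

/-- `STAB G k`: the convex hull of characteristic vectors of independent sets of size
exactly `k`. -/
noncomputable def STAB {V : Type*} (G : SimpleGraph V) (k : ℕ) : Set (V → ℝ) :=
  convexHull ℝ {x | ∃ S : Finset V, IsIndepSet G ↑S ∧ S.card = k ∧ x = charVec S}

/-- `STABle G k`: the convex hull of characteristic vectors of independent sets of size
at most `k`. -/
noncomputable def STABle {V : Type*} (G : SimpleGraph V) (k : ℕ) : Set (V → ℝ) :=
  convexHull ℝ {x | ∃ S : Finset V, IsIndepSet G ↑S ∧ S.card ≤ k ∧ x = charVec S}

/-- `P ⊆ ℝ^V` admits an extended formulation of size `N`: there is a polyhedron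
`Q = {x : A x ≤ b, C x = d}` where `A` has `N` rows, and a linear projection `π`
with `π(Q) = P`. -/
def HasEF {V : Type*} (P : Set (V → ℝ)) (N : ℕ) : Prop :=
  ∃ (m p : ℕ) (A : Matrix (Fin N) (Fin m) ℝ) (b : Fin N → ℝ)
    (C : Matrix (Fin p) (Fin m) ℝ) (d : Fin p → ℝ)
    (π : (Fin m → ℝ) →ₗ[ℝ] (V → ℝ)),
    π '' {x | A.mulVec x ≤ b ∧ C.mulVec x = d} = P


/-- Vertices of the paired local-cut graph `PLC(k,n)` with `L = ⌊log₂ n⌋`: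
cut vertices `(i, S)` with `i ∈ [k]`, `S ⊆ [L]`, and pairing vertices `(i, j, S, S')`
with `i ≠ j ∈ [k]`, `S, S' ⊆ [L]`. -/
abbrev PLCVertex (k L : ℕ) :=
  (Fin k × Finset (Fin L)) ⊕
    ({ij : Fin k × Fin k // ij.1 ≠ ij.2} × Finset (Fin L) × Finset (Fin L))

/-- The base relation generating the edges of `PLC(k,n)`. -/
def plcRel (k L : ℕ) : PLCVertex k L → PLCVertex k L → Prop
  | Sum.inl a, Sum.inl b => a.1 = b.1
  | Sum.inr a, Sum.inr b => a.1 = b.1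
  | Sum.inl a, Sum.inr b => (a.1 = b.1.1.1 ∧ a.2 ≠ b.2.1) ∨ (a.1 = b.1.1.2 ∧ a.2 ≠ b.2.2)
  | Sum.inr _, Sum.inl _ => False

/-- The paired local-cut graph `PLC(k,n)`: two distinct cut vertices with the same first
coordinate are adjacent; two distinct pairing vertices with the same first two coordinates
are adjacent; a cut vertex `(i,S)` and a pairing vertex `(j₁,j₂,S₁,S₂)` are adjacent iff
(`i = j₁` and `S ≠ S₁`) or (`i = j₂` and `S ≠ S₂`). -/
def PLC (k n : ℕ) : SimpleGraph (PLCVertex k (Nat.log 2 n)) :=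
  SimpleGraph.fromRel (plcRel k (Nat.log 2 n))

open Finset in
open scoped Classical in
/-- A combinatorial rectangle containing no pair of sets that meet in exactly one element
contains at most `2 ^ #s` pairs of disjoint subsets of `s`. -/
theorem sum_disjoint_rectangle_le {α : Type*} (s : Finset α) (A B : Finset α → Prop)
    (h : ∀ a ⊆ s, ∀ b ⊆ s, A a → B b → #(a ∩ b) ≠ 1) :
    ∑ a ∈ s.powerset, ∑ b ∈ s.powerset, (if A a ∧ B b ∧ Disjoint a b then 1 else 0) ≤
      2 ^ #s := by
  induction s using Finset.induction_on generalizing A B with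
  | empty => simp only [powerset_empty, sum_singleton, card_empty, pow_zero]; split_ifs <;> simp
  | insert x s hx ih =>
    have ihA := ih (fun a ↦ A a ∨ A (insert x a)) B (by
      rintro a ha b hb (hA | hA) hB
      · exact h a (ha.trans (subset_insert _ _)) b (hb.trans (subset_insert _ _)) hA hB
      · have := h _ (insert_subset_insert x ha) b (hb.trans (subset_insert _ _)) hA hB
        rwa [insert_inter_of_notMem fun hxb ↦ hx (hb hxb)] at this)
    have ihB := ih A (fun b ↦ B b ∨ B (insert x b)) (by
      rintro a ha b hb hA (hB | hB)
      · exact h a (ha.trans (subset_insert _ _)) b (hb.trans (subset_insert _ _)) hA hB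
      · have := h a (ha.trans (subset_insert _ _)) _ (insert_subset_insert x hb) hA hB
        rwa [inter_insert_of_notMem fun hxa ↦ hx (ha hxa)] at this)
    rw [card_insert_of_notMem hx, pow_succ, mul_two]
    refine le_trans ?_ (add_le_add ihA ihB)
    rw [sum_powerset_insert hx]
    simp_rw [sum_powerset_insert hx]
    rw [← sum_add_distrib, ← sum_add_distrib]
    refine sum_le_sum fun a ha ↦ ?_
    rw [← sum_add_distrib, ← sum_add_distrib, ← sum_add_distrib, ← sum_add_distrib]
    refine sum_le_sum fun b hb ↦ ?_
    rw [mem_powerset] at ha hb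
    have hxa : x ∉ a := fun hxa ↦ hx (ha hxa)
    have hxb : x ∉ b := fun hxb ↦ hx (hb hxb)
    have hbad : A (insert x a) → B (insert x b) → ¬ Disjoint a b := fun hA hB hab ↦
      h _ (insert_subset_insert x ha) _ (insert_subset_insert x hb) hA hB (by
        rw [← insert_inter_distrib, disjoint_iff_inter_eq_empty.1 hab]; simp)
    simp only [disjoint_insert_left, disjoint_insert_right, mem_insert, true_or, not_true,
      false_and, and_false, if_false, hxa, hxb, not_false_eq_true, true_and, add_zero]
    by_cases hab : Disjoint a b
    · replace hbad : ¬ (A (insert x a) ∧ B (insert x b)) := fun hAB ↦ hbad hAB.1 hAB.2 hab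
      simp only [hab, and_true]
      clear ih ihA ihB h
      by_cases hA : A a <;> by_cases hA' : A (insert x a) <;> by_cases hB : B b <;>
        by_cases hB' : B (insert x b) <;> simp [hA, hA', hB, hB'] at hbad ⊢
    · simp [hab]

open Finset in
open scoped Classical in
theorem sum_disjoint_powerset {α : Type*} (s : Finset α) :
    ∑ a ∈ s.powerset, ∑ b ∈ s.powerset, (if Disjoint a b then 1 else 0) = 3 ^ #s := by
  induction s using Finset.induction_on with
  | empty => simp
  | insert x s hx ih =>
    rw [card_insert_of_notMem hx, pow_succ, ← ih, sum_powerset_insert hx]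
    simp_rw [sum_powerset_insert hx]
    rw [← sum_add_distrib, sum_mul]
    refine sum_congr rfl fun a ha ↦ ?_
    rw [← sum_add_distrib, ← sum_add_distrib, ← sum_add_distrib, sum_mul]
    refine sum_congr rfl fun b hb ↦ ?_
    rw [mem_powerset] at ha hb
    have hxa : x ∉ a := fun hxa ↦ hx (ha hxa)
    have hxb : x ∉ b := fun hxb ↦ hx (hb hxb)
    by_cases hab : Disjoint a b <;> simp [disjoint_insert_left, hxa, hxb, hab]

open Finset in
open scoped Classical in
/-- The Kaibel–Weltge bound: covering all disjoint pairs of subsets of `α` by rectangles without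
pairs that meet in exactly one element takes at least `(3 / 2) ^ |α|` rectangles. -/
theorem three_pow_le_of_rectangle_cover {α ι : Type*} [Fintype α] [Fintype ι]
    (A B : ι → Finset α → Prop)
    (hvalid : ∀ i a b, A i a → B i b → #(a ∩ b) ≠ 1)
    (hcover : ∀ a b, Disjoint a b → ∃ i, A i a ∧ B i b) :
    3 ^ Fintype.card α ≤ Fintype.card ι * 2 ^ Fintype.card α := by
  calc 3 ^ Fintype.card α
      = ∑ a ∈ (univ : Finset α).powerset, ∑ b ∈ (univ : Finset α).powerset,
          (if Disjoint a b then 1 else 0) := (sum_disjoint_powerset univ).symm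
    _ ≤ ∑ a ∈ (univ : Finset α).powerset, ∑ b ∈ (univ : Finset α).powerset,
          ∑ i : ι, (if A i a ∧ B i b ∧ Disjoint a b then 1 else 0) := by
        refine sum_le_sum fun a _ ↦ sum_le_sum fun b _ ↦ ?_
        split_ifs with hab
        · obtain ⟨i, hA, hB⟩ := hcover a b hab
          refine le_trans ?_ (single_le_sum (fun _ _ ↦ Nat.zero_le _) (mem_univ i))
          simp [hA, hB, hab]
        · exact Nat.zero_le _
    _ = ∑ i : ι, ∑ a ∈ (univ : Finset α).powerset, ∑ b ∈ (univ : Finset α).powerset,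
          (if A i a ∧ B i b ∧ Disjoint a b then 1 else 0) := by
        simp_rw [sum_comm (t := (univ : Finset ι))]
    _ ≤ ∑ _i : ι, 2 ^ Fintype.card α :=
        sum_le_sum fun i _ ↦ sum_disjoint_rectangle_le univ (A i) (B i)
          fun a _ b _ ↦ hvalid i a b
    _ = Fintype.card ι * 2 ^ Fintype.card α := by simp

open Filter Topology in
/-- If `c + ℓ` is nonnegative on a polyhedron and vanishes somewhere on it, then every point of the
polyhedron where it is positive violates the tightness of some inequality that is tight on
the whole face defined by `c + ℓ = 0`. -/
theorem exists_tight_on_face_of_pos {N m p : ℕ} (A : Matrix (Fin N) (Fin m) ℝ) (b : Fin N → ℝ)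
    (C : Matrix (Fin p) (Fin m) ℝ) (d : Fin p → ℝ) (ℓ : (Fin m → ℝ) →ₗ[ℝ] ℝ) (c : ℝ)
    (hnonneg : ∀ x, A.mulVec x ≤ b → C.mulVec x = d → 0 ≤ c + ℓ x)
    (hface : ∃ x, A.mulVec x ≤ b ∧ C.mulVec x = d ∧ c + ℓ x = 0)
    {y : Fin m → ℝ} (hyA : A.mulVec y ≤ b) (hyC : C.mulVec y = d) (hy : 0 < c + ℓ y) :
    ∃ i, (∀ x, A.mulVec x ≤ b → C.mulVec x = d → c + ℓ x = 0 → A.mulVec x i = b i) ∧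
      A.mulVec y i < b i := by
  by_contra! hcon
  have hstrict : ∀ i, A.mulVec y i < b i →
      ∃ x, A.mulVec x ≤ b ∧ C.mulVec x = d ∧ c + ℓ x = 0 ∧ A.mulVec x i < b i := by
    intro i hi
    by_contra! hx
    exact absurd (hcon i fun x h₁ h₂ h₃ ↦ le_antisymm (h₁ i) (hx x h₁ h₂ h₃)) (not_le.2 hi)
  obtain ⟨z, hzA, hzC, hz, hzstrict⟩ : ∃ z, A.mulVec z ≤ b ∧ C.mulVec z = d ∧ c + ℓ z = 0 ∧
      ∀ i ∈ (Finset.univ : Finset (Fin N)), A.mulVec y i < b i → A.mulVec z i < b i := by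
    induction (Finset.univ : Finset (Fin N)) using Finset.induction_on with
    | empty => simpa using hface
    | insert j s _ ih =>
      obtain ⟨z, hzA, hzC, hz, hzs⟩ := ih
      by_cases hj : A.mulVec y j < b j
      · obtain ⟨x, hxA, hxC, hx, hxj⟩ := hstrict j hj
        refine ⟨(1 / 2 : ℝ) • z + (1 / 2 : ℝ) • x, fun i ↦ ?_, ?_, ?_, fun i hi hyi ↦ ?_⟩
        · have := hzA i
          have := hxA i
          simp only [Matrix.mulVec_add, Matrix.mulVec_smul, Pi.add_apply, Pi.smul_apply,
            smul_eq_mul]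
          linarith
        · rw [Matrix.mulVec_add, Matrix.mulVec_smul, Matrix.mulVec_smul, hzC, hxC, ← add_smul]
          norm_num
        · simp only [map_add, map_smul, smul_eq_mul]
          linarith
        · have := hzA i
          have := hxA i
          simp only [Matrix.mulVec_add, Matrix.mulVec_smul, Pi.add_apply, Pi.smul_apply,
            smul_eq_mul]
          rcases Finset.mem_insert.1 hi with rfl | hi
          · linarith
          · have := hzs i hi hyi
            linarith
      · refine ⟨z, hzA, hzC, hz, fun i hi hyi ↦ ?_⟩
        rcases Finset.mem_insert.1 hi with rfl | hi
        · exact absurd hyi hj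
        · exact hzs i hi hyi
  have hev : ∀ᶠ ε : ℝ in 𝓝[>] 0, ∀ i, A.mulVec z i + ε * (A.mulVec z i - A.mulVec y i) ≤ b i := by
    refine eventually_all.2 fun i ↦ ?_
    rcases (hyA i).lt_or_eq with hi | hi
    · have hcont : Continuous fun ε : ℝ ↦
          A.mulVec z i + ε * (A.mulVec z i - A.mulVec y i) := by fun_prop
      refine nhdsWithin_le_nhds ((hcont.continuousAt.eventually_lt continuousAt_const ?_).mono
        fun _ h ↦ le_of_lt h)
      simpa using hzstrict i (Finset.mem_univ i) hi
    · filter_upwards [self_mem_nhdsWithin] with ε hε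
      have := mul_nonneg (le_of_lt (Set.mem_Ioi.1 hε)) (sub_nonneg.2 (hzA i))
      have := hzA i
      rw [hi]
      linarith
  obtain ⟨ε, hεb, hε⟩ := (hev.and self_mem_nhdsWithin).exists
  have hεpos : 0 < ε := hε
  have hbeyond := hnonneg (z + ε • (z - y))
    (fun i ↦ by
      simpa only [Matrix.mulVec_add, Matrix.mulVec_smul, Matrix.mulVec_sub, Pi.add_apply,
        Pi.smul_apply, Pi.sub_apply, smul_eq_mul] using hεb i)
    (by rw [Matrix.mulVec_add, Matrix.mulVec_smul, Matrix.mulVec_sub, hzC, hyC]; simp)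
  simp only [map_add, map_smul, map_sub, smul_eq_mul] at hbeyond
  have : ε * (ℓ z - ℓ y) < 0 := mul_neg_of_pos_of_neg hεpos (by linarith)
  linarith

open Finset in
/-- A polytope with vertices `v b` and valid inequalities `c a + ℓ a ≥ 0`, indexed by the subsets of
`α`, whose slack is `(1 - #(a ∩ b)) ^ 2`, has no small extended formulation. -/
theorem HasEF.three_pow_le {V α : Type*} [Fintype α] [DecidableEq α] {P : Set (V → ℝ)} {N : ℕ}
    (hP : HasEF P N) (v : Finset α → V → ℝ) (hv : ∀ b, v b ∈ P)
    (ℓ : Finset α → (V → ℝ) →ₗ[ℝ] ℝ) (hℓ : ∀ a, ∀ x ∈ P, 0 ≤ 1 + ℓ a x)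
    (hslack : ∀ a b, 1 + ℓ a (v b) = (1 - (#(a ∩ b) : ℝ)) ^ 2) :
    3 ^ Fintype.card α ≤ (N + 1) * 2 ^ Fintype.card α := by
  obtain ⟨m, p, A, b, C, d, π, rfl⟩ := hP
  choose y hy hπy using hv
  have key := three_pow_le_of_rectangle_cover (α := α) (ι := Option (Fin N))
    (fun o s ↦ o.elim (s = ∅) fun i ↦
      ∀ x, A.mulVec x ≤ b → C.mulVec x = d → 1 + ℓ s (π x) = 0 → A.mulVec x i = b i)
    (fun o t ↦ o.elim True fun i ↦ A.mulVec (y t) i < b i) ?_ ?_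
  · simpa using key
  · rintro (_ | i) s t hs ht
    · have : s = ∅ := hs
      simp [this]
    · intro hst
      have hst' : #(s ∩ t) = 1 := by convert hst
      have hs' := hs (y t) (hy t).1 (hy t).2 (by rw [hπy, hslack, hst']; simp)
      exact absurd hs' (ne_of_lt ht)
  · intro s t hst
    rcases s.eq_empty_or_nonempty with rfl | ⟨x, hx⟩
    · exact ⟨none, rfl, trivial⟩
    · obtain ⟨i, hi⟩ := exists_tight_on_face_of_pos A b C d ((ℓ s).comp π) 1
        (fun x hxA hxC ↦ hℓ s _ ⟨x, ⟨hxA, hxC⟩, rfl⟩)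
        ⟨y {x}, (hy _).1, (hy _).2, by
          rw [LinearMap.comp_apply, hπy, hslack, inter_singleton_of_mem hx]; simp⟩
        (hy t).1 (hy t).2 (by
          rw [LinearMap.comp_apply, hπy, hslack, disjoint_iff_inter_eq_empty.1 hst]; simp)
      exact ⟨some i, hi⟩

/-- The vertex of `PLC(k,n)` in a given class (a coordinate or an ordered pair of distinct
coordinates) determined by a choice of local cuts. -/
def plcVertexOfCut {k L : ℕ} (f : Fin k → Finset (Fin L)) :
    Fin k ⊕ {ij : Fin k × Fin k // ij.1 ≠ ij.2} → PLCVertex k L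
  | Sum.inl i => Sum.inl (i, f i)
  | Sum.inr q => Sum.inr (q, f q.1.1, f q.1.2)

/-- The class of a vertex of `PLC(k,n)`. -/
def plcClass {k L : ℕ} : PLCVertex k L → Fin k ⊕ {ij : Fin k × Fin k // ij.1 ≠ ij.2} :=
  Sum.map Prod.fst Prod.fst

theorem plcClass_plcVertexOfCut {k L : ℕ} (f : Fin k → Finset (Fin L))
    (c : Fin k ⊕ {ij : Fin k × Fin k // ij.1 ≠ ij.2}) :
    plcClass (plcVertexOfCut f c) = c := by
  cases c <;> rfl

theorem plcVertexOfCut_injective {k L : ℕ} (f : Fin k → Finset (Fin L)) :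
    Function.Injective (plcVertexOfCut f) :=
  Function.LeftInverse.injective (plcClass_plcVertexOfCut f)

/-- The independent set of `PLC(k,n)` determined by a choice of local cuts. -/
def plcIndepSet {k L : ℕ} (f : Fin k → Finset (Fin L)) : Finset (PLCVertex k L) :=
  Finset.univ.map ⟨plcVertexOfCut f, plcVertexOfCut_injective f⟩

theorem card_plcClass (k : ℕ) :
    Fintype.card (Fin k ⊕ {ij : Fin k × Fin k // ij.1 ≠ ij.2}) = k ^ 2 := by
  have h : Fintype.card {ij : Fin k × Fin k // ij.1 = ij.2} = k := by
    rw [Fintype.card_congr (⟨fun q ↦ q.1.1, fun i ↦ ⟨(i, i), rfl⟩, fun ⟨⟨i, j⟩, (h : i = j)⟩ ↦ by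
      subst h; rfl, fun _ ↦ rfl⟩ : {ij : Fin k × Fin k // ij.1 = ij.2} ≃ Fin k), Fintype.card_fin]
  have hle : k ≤ k * k := Nat.le_mul_self k
  rw [Fintype.card_sum, Fintype.card_fin, Fintype.card_subtype_compl, h, Fintype.card_prod,
    Fintype.card_fin, sq]
  omega

theorem card_plcIndepSet {k L : ℕ} (f : Fin k → Finset (Fin L)) :
    (plcIndepSet f).card = k ^ 2 := by
  rw [plcIndepSet, Finset.card_map, Finset.card_univ, card_plcClass]

theorem isIndepSet_plcIndepSet {k n : ℕ} (f : Fin k → Finset (Fin (Nat.log 2 n))) :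
    IsIndepSet (PLC k n) ↑(plcIndepSet f) := by
  intro u hu v hv
  simp only [plcIndepSet, Finset.coe_map, Finset.coe_univ, Set.image_univ, Set.mem_range,
    Function.Embedding.coeFn_mk] at hu hv
  obtain ⟨c, rfl⟩ := hu
  obtain ⟨c', rfl⟩ := hv
  rw [PLC, SimpleGraph.fromRel_adj]
  rintro ⟨hne, h⟩
  rcases c with i | q <;> rcases c' with i' | q' <;> simp only [plcVertexOfCut, plcRel] at h hne <;>
    grind

/-- Every independent set of size `k ^ 2` in `PLC(k,n)` comes from a choice of local cuts. -/
theorem exists_eq_plcIndepSet {k n : ℕ} {T : Finset (PLCVertex k (Nat.log 2 n))}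
    (hT : IsIndepSet (PLC k n) ↑T) (hcard : T.card = k ^ 2) : ∃ f, T = plcIndepSet f := by
  have hadj : ∀ u ∈ T, ∀ v ∈ T, u ≠ v → ¬ plcRel _ _ u v := fun u hu v hv huv h ↦
    hT hu hv ((SimpleGraph.fromRel_adj _ _ _).2 ⟨huv, Or.inl h⟩)
  have hinj : Set.InjOn plcClass (T : Set (PLCVertex k (Nat.log 2 n))) := by
    intro u hu v hv huv
    by_contra hne
    refine hadj u hu v hv hne ?_
    rcases u with u | u <;> rcases v with v | v <;> simp_all [plcClass, plcRel]
  have himage : T.image plcClass = Finset.univ := by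
    rw [← Finset.card_eq_iff_eq_univ, Finset.card_image_of_injOn hinj, hcard, card_plcClass]
  have hcut : ∀ i, ∃ S, Sum.inl (i, S) ∈ T := by
    intro i
    obtain ⟨u, hu, hui⟩ := Finset.mem_image.1 (himage ▸ Finset.mem_univ (Sum.inl i))
    rcases u with ⟨i', S⟩ | u
    · obtain rfl : i' = i := Sum.inl.inj hui
      exact ⟨S, hu⟩
    · cases hui
  choose f hf using hcut
  refine ⟨f, Finset.eq_of_subset_of_card_le (fun u hu ↦ ?_)
    (by rw [card_plcIndepSet, hcard])⟩
  refine Finset.mem_map.2 ⟨plcClass u, Finset.mem_univ _, ?_⟩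
  rcases u with ⟨i, S⟩ | ⟨q, S, S'⟩
  · exact hinj (hf i) hu rfl
  · have hS : f q.1.1 = S := by
      by_contra hne
      exact hadj _ (hf q.1.1) _ hu Sum.inl_ne_inr (Or.inl ⟨rfl, hne⟩)
    have hS' : f q.1.2 = S' := by
      by_contra hne
      exact hadj _ (hf q.1.2) _ hu Sum.inl_ne_inr (Or.inr ⟨rfl, hne⟩)
    change Sum.inr (q, f q.1.1, f q.1.2) = _
    rw [hS, hS']

theorem sum_mul_charVec {V : Type*} [Fintype V] (w : V → ℝ) (T : Finset V) :
    ∑ v, w v * charVec T v = ∑ v ∈ T, w v := by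
  classical
  simp [charVec, Set.indicator_apply, Finset.sum_ite_mem]

/-- The weights on the vertices of `PLC(k,n)` expressing `(1 - ∑ i, #(g i ∩ f i)) ^ 2` as an affine
function on independent sets. -/
def plcWeight {k L : ℕ} (g : Fin k → Finset (Fin L)) : PLCVertex k L → ℝ
  | Sum.inl (i, S) => ((g i ∩ S).card : ℝ) ^ 2 - 2 * (g i ∩ S).card
  | Sum.inr (q, S, S') => ((g q.1.1 ∩ S).card : ℝ) * (g q.1.2 ∩ S').card

theorem one_add_sum_plcWeight {k L : ℕ} (g f : Fin k → Finset (Fin L)) :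
    1 + ∑ v ∈ plcIndepSet f, plcWeight g v = (1 - ∑ i, ((g i ∩ f i).card : ℝ)) ^ 2 := by
  set t : Fin k → ℝ := fun i ↦ ((g i ∩ f i).card : ℝ)
  have hoff : ∑ q : {ij : Fin k × Fin k // ij.1 ≠ ij.2}, t q.1.1 * t q.1.2 =
      (∑ i, t i) ^ 2 - ∑ i, t i ^ 2 := by
    rw [← Finset.sum_subtype (Finset.univ.filter fun ij : Fin k × Fin k ↦ ij.1 ≠ ij.2) (by simp)
      (fun ij ↦ t ij.1 * t ij.2), sq, Finset.sum_mul_sum, ← Finset.sum_product',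
      Finset.univ_product_univ, eq_sub_iff_add_eq,
      ← Finset.sum_filter_not_add_sum_filter Finset.univ
        (fun ij : Fin k × Fin k ↦ ij.1 = ij.2)]
    congr 1
    rw [Finset.sum_filter, Fintype.sum_prod_type]
    simp [sq]
  rw [plcIndepSet, Finset.sum_map, Fintype.sum_sum_type]
  change 1 + (∑ i, (t i ^ 2 - 2 * t i) + ∑ q : {ij : Fin k × Fin k // ij.1 ≠ ij.2},
    t q.1.1 * t q.1.2) = _
  rw [hoff, Finset.sum_sub_distrib, ← Finset.mul_sum]
  ring

/-- The local parts of a subset of `[k] × [L]`. -/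
def finsetSection {k L : ℕ} (b : Finset (Fin k × Fin L)) (i : Fin k) : Finset (Fin L) :=
  Finset.univ.filter fun l ↦ (i, l) ∈ b

theorem sum_card_finsetSection_inter {k L : ℕ} (a b : Finset (Fin k × Fin L)) :
    ∑ i, (finsetSection a i ∩ finsetSection b i).card = (a ∩ b).card := by
  have h : ∀ i, finsetSection a i ∩ finsetSection b i = finsetSection (a ∩ b) i := fun i ↦ by
    ext l; simp [finsetSection]
  simp_rw [h, finsetSection, Finset.card_filter]
  rw [← Fintype.sum_prod_type (f := fun x : Fin k × Fin L ↦ if x ∈ a ∩ b then 1 else 0),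
    ← Finset.card_filter, Finset.filter_univ_mem]

theorem three_pow_le_of_hasEF_stab_plc {k n N : ℕ} (h : HasEF (STAB (PLC k n) (k ^ 2)) N) :
    3 ^ (k * Nat.log 2 n) ≤ (N + 1) * 2 ^ (k * Nat.log 2 n) := by
  let ℓ (a : Finset (Fin k × Fin (Nat.log 2 n))) :
      (PLCVertex k (Nat.log 2 n) → ℝ) →ₗ[ℝ] ℝ :=
    ∑ v, plcWeight (finsetSection a) v • LinearMap.proj v
  have hℓ : ∀ a T, ℓ a (charVec T) = ∑ v ∈ T, plcWeight (finsetSection a) v := fun a T ↦ by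
    simp only [ℓ, LinearMap.sum_apply, LinearMap.smul_apply, LinearMap.proj_apply, smul_eq_mul]
    exact sum_mul_charVec _ _
  have key := h.three_pow_le (fun b ↦ charVec (plcIndepSet (finsetSection b)))
    (fun b ↦ subset_convexHull _ _
      ⟨_, isIndepSet_plcIndepSet _, card_plcIndepSet _, rfl⟩) ℓ ?_ ?_
  · simpa using key
  · intro a x hx
    have hsub : STAB (PLC k n) (k ^ 2) ⊆ {x | -1 ≤ ℓ a x} := by
      refine convexHull_min ?_ (convex_halfSpace_ge (ℓ a).isLinear _)
      rintro _ ⟨T, hT, hcard, rfl⟩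
      obtain ⟨f, rfl⟩ := exists_eq_plcIndepSet hT hcard
      have := one_add_sum_plcWeight (finsetSection a) f
      have := sq_nonneg (1 - ∑ i, ((finsetSection a i ∩ f i).card : ℝ))
      rw [Set.mem_ofPred_eq, hℓ]
      linarith
    have : -1 ≤ ℓ a x := hsub hx
    linarith
  · intro a b
    rw [hℓ, one_add_sum_plcWeight, ← sum_card_finsetSection_inter]
    push_cast
    rfl

theorem five_fourths_pow_add_one_le {r : ℕ} (hr : 3 ≤ r) :
    (5 / 4 : ℝ) ^ r + 1 ≤ (3 / 2) ^ r := by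
  induction r, hr using Nat.le_induction with
  | base => norm_num
  | succ r _ ih =>
    have : (0 : ℝ) < (5 / 4) ^ r := by positivity
    rw [pow_succ, pow_succ]
    linarith

/-- There exist a constant `c' > 0` and a threshold `n₀` such that for all `k ≥ 1` and
`n ≥ n₀`, every extended formulation of `STAB_{k²}(PLC(k,n))` has size at least `n^(c'·k)`. -/
theorem plc_stab_xc_lower_bound :
    ∃ c' : ℝ, 0 < c' ∧ ∃ n₀ : ℕ, ∀ k n : ℕ, 1 ≤ k → n₀ ≤ n →
      ∀ N : ℕ, HasEF (STAB (PLC k n) (k ^ 2)) N → (n : ℝ) ^ (c' * k) ≤ (N : ℝ) := by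
  refine ⟨1 / 8, by norm_num, 8, fun k n hk hn N hN ↦ ?_⟩
  set L := Nat.log 2 n
  have hL3 : 3 ≤ L := (Nat.le_log_iff_pow_le (by norm_num) (by omega)).2 (by omega)
  have hr : 3 ≤ k * L := hL3.trans (Nat.le_mul_of_pos_left L hk)
  have hcover : (3 : ℝ) ^ (k * L) ≤ (N + 1) * 2 ^ (k * L) := by
    exact_mod_cast three_pow_le_of_hasEF_stab_plc hN
  have hN' : (3 / 2 : ℝ) ^ (k * L) ≤ N + 1 := by
    rw [div_pow, div_le_iff₀ (by positivity)]
    exact hcover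
  have hn2 : (n : ℝ) ≤ 2 ^ (2 * L) := by
    have : n ≤ 2 ^ (2 * L) := (Nat.lt_pow_succ_log_self (by norm_num) n).le.trans
      (Nat.pow_le_pow_right (by norm_num) (by omega))
    exact_mod_cast this
  have hroot : (2 : ℝ) ^ (1 / 4 : ℝ) ≤ 5 / 4 := by
    calc (2 : ℝ) ^ (1 / 4 : ℝ) ≤ ((5 / 4 : ℝ) ^ (4 : ℕ)) ^ (1 / 4 : ℝ) :=
          Real.rpow_le_rpow (by norm_num) (by norm_num) (by norm_num)
      _ = 5 / 4 := by
          rw [← Real.rpow_natCast, ← Real.rpow_mul (by norm_num)]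
          norm_num
  calc (n : ℝ) ^ (1 / 8 * k : ℝ) ≤ ((2 : ℝ) ^ (2 * L)) ^ (1 / 8 * k : ℝ) :=
        Real.rpow_le_rpow (by positivity) hn2 (by positivity)
    _ = ((2 : ℝ) ^ (1 / 4 : ℝ)) ^ (k * L) := by
        rw [← Real.rpow_natCast, ← Real.rpow_natCast, ← Real.rpow_mul (by norm_num),
          ← Real.rpow_mul (by norm_num)]
        congr 1
        push_cast
        ring
    _ ≤ (5 / 4) ^ (k * L) := pow_le_pow_left₀ (by positivity) hroot _
    _ ≤ N := by linarith [five_fourths_pow_add_one_le hr]
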